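/- Let A be an irreducible aperiodic 0-1 matrix with A^d > 0, defining a mixing subshift Σ with h_top(σ) > 0. Fix a Hölder potential φ, and for z ∈ Σ let Σ̃_n = Σ \ ∪_{k≥0} σ^{-k}[z]_{l_n} where l_n → ∞. Then the restricted pressures converge: lim_{n→∞} P_{Σ̃_n}(φ) = P(φ). -/

import Mathlib

open MeasureTheory Filter

noncomputable section

/-- The left shift on one-sided sequences. -/
def shiftSeq {α : Type*} : (ℕ → α) → ℕ → α := fun x n => x (n + 1)

/-- The cylinder of length `n` centred at `x`. -/
def cyl {α : Type*} (x : ℕ → α) (n : ℕ) : Set (ℕ → α) := {y | ∀ i < n, y i = x i}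

/-- The Birkhoff sum `φᵏ(x)`. -/
def birk {α : Type*} (φ : (ℕ → α) → ℝ) (n : ℕ) (x : ℕ → α) : ℝ :=
  ∑ i ∈ Finset.range n, φ (shiftSeq^[i] x)

/-- The cylinder set determined by a word `w` of length `k`. -/
def cylword {l k : ℕ} (w : Fin k → Fin l) : Set (ℕ → Fin l) :=
  {y | ∀ i : Fin k, y i.1 = w i}

open Classical in
/-- The `k`-th partition sum of `φ` over a set `Y`:
`Σ_{[w] ∩ Y ≠ ∅} exp (sup_{[w] ∩ Y} φᵏ)`. -/
def partSum {l : ℕ} (φ : (ℕ → Fin l) → ℝ) (k : ℕ) (Y : Set (ℕ → Fin l)) : ℝ :=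
  ∑ w : Fin k → Fin l,
    if (cylword w ∩ Y).Nonempty then
      Real.exp (sSup (birk φ k '' (cylword w ∩ Y)))
    else 0

/-- The topological pressure of `φ` restricted to `Y`, via partition sums. -/
def pressOn {l : ℕ} (φ : (ℕ → Fin l) → ℝ) (Y : Set (ℕ → Fin l)) : ℝ :=
  Filter.limsup (fun k : ℕ => Real.log (partSum φ k Y) / k) Filter.atTop

/-- The summand of the partition sum. -/
def pterm {l : ℕ} (φ : (ℕ → Fin l) → ℝ) (k : ℕ) (Y : Set (ℕ → Fin l)) (w : Fin k → Fin l) : ℝ :=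
  open Classical in
  if (cylword w ∩ Y).Nonempty then
      Real.exp (sSup (birk φ k '' (cylword w ∩ Y)))
    else 0

lemma partSum_eq {l : ℕ} (φ : (ℕ → Fin l) → ℝ) (k : ℕ) (Y : Set (ℕ → Fin l)) :
    partSum φ k Y = ∑ w : Fin k → Fin l, pterm φ k Y w := rfl

lemma pterm_of {l : ℕ} {φ : (ℕ → Fin l) → ℝ} {k : ℕ} {Y : Set (ℕ → Fin l)} {w : Fin k → Fin l}
    (h : (cylword w ∩ Y).Nonempty) :
    pterm φ k Y w = Real.exp (sSup (birk φ k '' (cylword w ∩ Y))) := by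
  unfold pterm; rw [if_pos h]

lemma pterm_of_not {l : ℕ} {φ : (ℕ → Fin l) → ℝ} {k : ℕ} {Y : Set (ℕ → Fin l)}
    {w : Fin k → Fin l} (h : ¬ (cylword w ∩ Y).Nonempty) :
    pterm φ k Y w = 0 := by
  unfold pterm; rw [if_neg h]

lemma pterm_nonneg {l : ℕ} (φ : (ℕ → Fin l) → ℝ) (k : ℕ) (Y : Set (ℕ → Fin l))
    (w : Fin k → Fin l) : 0 ≤ pterm φ k Y w := by
  unfold pterm; split_ifs
  · exact (Real.exp_pos _).le
  · exact le_rfl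

lemma shift_iter {α : Type*} (x : ℕ → α) (k n : ℕ) : (shiftSeq^[k] x) n = x (k + n) := by
  induction k generalizing x with
  | zero => simp
  | succ k ih =>
    rw [Function.iterate_succ_apply, ih]
    simp only [shiftSeq]
    congr 1; omega

lemma birk_add {α : Type*} (φ : (ℕ → α) → ℝ) (m n : ℕ) (x : ℕ → α) :
    birk φ (m + n) x = birk φ m x + birk φ n (shiftSeq^[m] x) := by
  unfold birk
  rw [Finset.sum_range_add]
  congr 1
  apply Finset.sum_congr rfl
  intro i _
  rw [← Function.iterate_add_apply, add_comm]

lemma birk_abs {α : Type*} {φ : (ℕ → α) → ℝ} {B : ℝ} (hB : ∀ x, |φ x| ≤ B) (n : ℕ) (x : ℕ → α) :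
    |birk φ n x| ≤ n * B := by
  unfold birk
  refine (Finset.abs_sum_le_sum_abs _ _).trans ?_
  refine (Finset.sum_le_sum (fun i _ => hB _)).trans ?_
  simp

lemma birk_bdd {l : ℕ} {φ : (ℕ → Fin l) → ℝ} {B : ℝ} (hB : ∀ x, |φ x| ≤ B) (n : ℕ)
    (S : Set (ℕ → Fin l)) : BddAbove (birk φ n '' S) := by
  refine ⟨n * B, ?_⟩
  rintro _ ⟨x, _, rfl⟩
  exact (abs_le.1 (birk_abs hB n x)).2

lemma word_self {l : ℕ} {Y : Set (ℕ → Fin l)} {x : ℕ → Fin l} (hx : x ∈ Y) (k : ℕ) :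
    x ∈ cylword (fun i : Fin k => x i.1) ∩ Y := ⟨fun _ => rfl, hx⟩

lemma partSum_lower {l : ℕ} {φ : (ℕ → Fin l) → ℝ} {B : ℝ} (hB : ∀ x, |φ x| ≤ B) (k : ℕ)
    {Y : Set (ℕ → Fin l)} (hY : Y.Nonempty) : Real.exp (-(k * B)) ≤ partSum φ k Y := by
  obtain ⟨x, hx⟩ := hY
  have h1 : pterm φ k Y (fun i : Fin k => x i.1) ≤ partSum φ k Y := by
    rw [partSum_eq]
    exact Finset.single_le_sum (fun w _ => pterm_nonneg φ k Y w) (Finset.mem_univ _)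
  refine le_trans ?_ h1
  rw [pterm_of ⟨x, word_self hx k⟩]
  apply Real.exp_le_exp.2
  refine le_trans ?_ (le_csSup (birk_bdd hB k _) ⟨x, word_self hx k, rfl⟩)
  exact (abs_le.1 (birk_abs hB k x)).1

lemma partSum_upper {l : ℕ} {φ : (ℕ → Fin l) → ℝ} {B : ℝ} (hB : ∀ x, |φ x| ≤ B) (k : ℕ)
    (Y : Set (ℕ → Fin l)) : partSum φ k Y ≤ (l : ℝ) ^ k * Real.exp (k * B) := by
  rw [partSum_eq]
  refine (Finset.sum_le_sum (g := fun _ => Real.exp (k * B)) ?_).trans ?_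
  · intro w _
    by_cases h : (cylword w ∩ Y).Nonempty
    · rw [pterm_of h]
      apply Real.exp_le_exp.2
      apply csSup_le (h.image _)
      rintro _ ⟨x, _, rfl⟩
      exact (abs_le.1 (birk_abs hB k x)).2
    · rw [pterm_of_not h]; positivity
  · simp

lemma partSum_pos {l : ℕ} {φ : (ℕ → Fin l) → ℝ} {B : ℝ} (hB : ∀ x, |φ x| ≤ B) (k : ℕ)
    {Y : Set (ℕ → Fin l)} (hY : Y.Nonempty) : 0 < partSum φ k Y :=
  (Real.exp_pos _).trans_le (partSum_lower hB k hY)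

lemma partSum_mono {l : ℕ} {φ : (ℕ → Fin l) → ℝ} {B : ℝ} (hB : ∀ x, |φ x| ≤ B) (k : ℕ)
    {X Y : Set (ℕ → Fin l)} (hXY : X ⊆ Y) : partSum φ k X ≤ partSum φ k Y := by
  rw [partSum_eq, partSum_eq]
  apply Finset.sum_le_sum
  intro w _
  by_cases h : (cylword w ∩ X).Nonempty
  · have hs : cylword w ∩ X ⊆ cylword w ∩ Y := Set.inter_subset_inter_right _ hXY
    rw [pterm_of h, pterm_of (h.mono hs)]
    apply Real.exp_le_exp.2
    exact csSup_le_csSup (birk_bdd hB k _) (h.image _) (Set.image_mono hs)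
  · rw [pterm_of_not h]; exact pterm_nonneg _ _ _ _

lemma log_abs {l : ℕ} {φ : (ℕ → Fin l) → ℝ} {B : ℝ} (hB : ∀ x, |φ x| ≤ B) (k : ℕ)
    {Y : Set (ℕ → Fin l)} (hY : Y.Nonempty) :
    |Real.log (partSum φ k Y) / k| ≤ B + Real.log l := by
  obtain ⟨x0, hx0⟩ := hY
  have hl : 1 ≤ l := by have := (x0 0).2; omega
  have hl' : (1 : ℝ) ≤ l := by exact_mod_cast hl
  have hB0 : 0 ≤ B := (abs_nonneg _).trans (hB x0)
  have hlog : 0 ≤ Real.log l := Real.log_nonneg hl'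
  rcases Nat.eq_zero_or_pos k with rfl | hk
  · simp; positivity
  have hk' : (0 : ℝ) < k := by exact_mod_cast hk
  have h1 := Real.log_le_log (Real.exp_pos _) (partSum_lower hB k ⟨x0, hx0⟩)
  have h2 := Real.log_le_log (partSum_pos hB k ⟨x0, hx0⟩) (partSum_upper hB k Y)
  rw [Real.log_exp] at h1
  rw [Real.log_mul (by positivity) (by positivity), Real.log_exp, Real.log_pow] at h2
  rw [abs_le, le_div_iff₀ hk', div_le_iff₀ hk']
  constructor
  · nlinarith
  · nlinarith

lemma press_bdd {l : ℕ} {φ : (ℕ → Fin l) → ℝ} {B : ℝ} (hB : ∀ x, |φ x| ≤ B)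
    {Y : Set (ℕ → Fin l)} (hY : Y.Nonempty) :
    IsBoundedUnder (· ≤ ·) atTop (fun k : ℕ => Real.log (partSum φ k Y) / k) ∧
    IsBoundedUnder (· ≥ ·) atTop (fun k : ℕ => Real.log (partSum φ k Y) / k) :=
  ⟨isBoundedUnder_of ⟨_, fun k => (abs_le.1 (log_abs hB k hY)).2⟩,
   isBoundedUnder_of ⟨_, fun k => (abs_le.1 (log_abs hB k hY)).1⟩⟩

lemma press_mono {l : ℕ} {φ : (ℕ → Fin l) → ℝ} {B : ℝ} (hB : ∀ x, |φ x| ≤ B)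
    {X Y : Set (ℕ → Fin l)} (hX : X.Nonempty) (hXY : X ⊆ Y) : pressOn φ X ≤ pressOn φ Y := by
  unfold pressOn
  apply limsup_le_limsup
  · refine Eventually.of_forall (fun k => ?_)
    dsimp only
    apply div_le_div_of_nonneg_right _ (Nat.cast_nonneg k)
    exact Real.log_le_log (partSum_pos hB k hX) (partSum_mono hB k hXY)
  · exact (press_bdd hB hX).2.isCoboundedUnder_le
  · exact (press_bdd hB (hX.mono hXY)).1

lemma mem_cyl_append {l m n : ℕ} (a : Fin m → Fin l) (b : Fin n → Fin l) (x : ℕ → Fin l) :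
    x ∈ cylword (Fin.append a b) ↔ x ∈ cylword a ∧ shiftSeq^[m] x ∈ cylword b := by
  constructor
  · intro h
    refine ⟨fun i => ?_, fun i => ?_⟩
    · have := h (Fin.castAdd n i)
      rwa [Fin.append_left] at this
    · have := h (Fin.natAdd m i)
      rw [Fin.append_right] at this
      rw [shift_iter]; exact this
  · rintro ⟨h1, h2⟩ i
    refine Fin.addCases (fun i => ?_) (fun i => ?_) i
    · rw [Fin.append_left]; exact h1 i
    · rw [Fin.append_right, ← h2 i, shift_iter]; rfl

lemma partSum_submul {l : ℕ} {φ : (ℕ → Fin l) → ℝ} {B : ℝ} (hB : ∀ x, |φ x| ≤ B)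
    {Y : Set (ℕ → Fin l)} (hY : ∀ x ∈ Y, ∀ k, shiftSeq^[k] x ∈ Y) (m n : ℕ) :
    partSum φ (m + n) Y ≤ partSum φ m Y * partSum φ n Y := by
  rw [partSum_eq, partSum_eq, partSum_eq, Fintype.sum_mul_sum, ← Fintype.sum_prod_type',
    ← (Fin.appendEquiv m n).sum_comp]
  apply Finset.sum_le_sum
  rintro ⟨a, b⟩ _
  change pterm φ (m + n) Y (Fin.append a b) ≤ pterm φ m Y a * pterm φ n Y b
  by_cases h : (cylword (Fin.append a b) ∩ Y).Nonempty
  · have key : ∀ x ∈ cylword (Fin.append a b) ∩ Y,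
        x ∈ cylword a ∩ Y ∧ shiftSeq^[m] x ∈ cylword b ∩ Y := by
      rintro x ⟨hx, hxY⟩
      rw [mem_cyl_append] at hx
      exact ⟨⟨hx.1, hxY⟩, hx.2, hY x hxY m⟩
    obtain ⟨x0, hx0⟩ := id h
    rw [pterm_of h, pterm_of ⟨x0, (key x0 hx0).1⟩, pterm_of ⟨_, (key x0 hx0).2⟩, ← Real.exp_add]
    apply Real.exp_le_exp.2
    apply csSup_le (h.image _)
    rintro _ ⟨x, hx, rfl⟩
    rw [birk_add]
    exact add_le_add (le_csSup (birk_bdd hB m _) ⟨x, (key x hx).1, rfl⟩)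
      (le_csSup (birk_bdd hB n _) ⟨_, (key x hx).2, rfl⟩)
  · rw [pterm_of_not h]; exact mul_nonneg (pterm_nonneg _ _ _ _) (pterm_nonneg _ _ _ _)

lemma press_le_log {l : ℕ} {φ : (ℕ → Fin l) → ℝ} {B : ℝ} (hB : ∀ x, |φ x| ≤ B)
    {Y : Set (ℕ → Fin l)} (hYn : Y.Nonempty) (hY : ∀ x ∈ Y, ∀ k, shiftSeq^[k] x ∈ Y) (n : ℕ)
    (hn : n ≠ 0) : n * pressOn φ Y ≤ Real.log (partSum φ n Y) := by
  have hsub : Subadditive (fun n => Real.log (partSum φ n Y)) := by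
    intro m n
    dsimp only
    rw [← Real.log_mul (partSum_pos hB m hYn).ne' (partSum_pos hB n hYn).ne']
    exact Real.log_le_log (partSum_pos hB _ hYn) (partSum_submul hB hY m n)
  have hb : BddBelow (Set.range fun n : ℕ => Real.log (partSum φ n Y) / n) := by
    refine ⟨-(B + Real.log l), ?_⟩
    rintro _ ⟨k, rfl⟩
    exact (abs_le.1 (log_abs hB k hYn)).1
  have h1 : pressOn φ Y = hsub.lim := (hsub.tendsto_lim hb).limsup_eq
  have h2 := hsub.lim_le_div hb hn
  have hn' : (0 : ℝ) < n := by positivity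
  rw [h1, mul_comm]
  exact (le_div_iff₀ hn').1 h2

/-- Gluing two sequences at time `n`. -/
def glue {α : Type*} (n : ℕ) (v w : ℕ → α) : ℕ → α := fun t => if t ≤ n then v t else w (t - n)

lemma glue_le {α : Type*} {n : ℕ} {v w : ℕ → α} {t : ℕ} (h : t ≤ n) : glue n v w t = v t := by
  unfold glue; rw [if_pos h]

lemma glue_add {α : Type*} {n : ℕ} {v w : ℕ → α} (hvw : v n = w 0) (t : ℕ) :
    glue n v w (n + t) = w t := by
  unfold glue
  split_ifs with h
  · have : t = 0 := by omega
    subst this; simpa using hvw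
  · congr 1; omega

/-- An admissible path of `n` steps. -/
def IsPth {l : ℕ} (A : Matrix (Fin l) (Fin l) ℕ) (v : ℕ → Fin l) (n : ℕ) : Prop :=
  ∀ t < n, A (v t) (v (t + 1)) = 1

lemma glue_path {l : ℕ} {A : Matrix (Fin l) (Fin l) ℕ} {v w : ℕ → Fin l} {n k : ℕ}
    (hv : IsPth A v n) (hw : IsPth A w k) (hvw : v n = w 0) : IsPth A (glue n v w) (n + k) := by
  intro t ht
  by_cases h : t < n
  · rw [glue_le h.le, glue_le (by omega)]; exact hv t h
  · obtain ⟨r, rfl⟩ := Nat.exists_eq_add_of_le (not_lt.1 h)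
    rw [glue_add hvw, add_assoc, glue_add hvw]
    exact hw r (by omega)

lemma exists_path {l : ℕ} {A : Matrix (Fin l) (Fin l) ℕ} (h01 : ∀ i j, A i j = 0 ∨ A i j = 1)
    (n : ℕ) : ∀ i j, 0 < (A ^ n) i j → ∃ p : ℕ → Fin l, p 0 = i ∧ p n = j ∧ IsPth A p n := by
  induction n with
  | zero =>
    intro i j h
    have hij : i = j := by
      by_contra hne
      simp [Matrix.one_apply, hne] at h
    exact ⟨fun _ => i, rfl, hij, fun t ht => absurd ht (by omega)⟩
  | succ n ih =>
    intro i j h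
    rw [pow_succ, Matrix.mul_apply] at h
    obtain ⟨k, _, hk⟩ := Finset.exists_ne_zero_of_sum_ne_zero h.ne'
    have h1 : 0 < (A ^ n) i k := Nat.pos_of_ne_zero (left_ne_zero_of_mul hk)
    have h2 : A k j = 1 := (h01 k j).resolve_left (right_ne_zero_of_mul hk)
    obtain ⟨p, hp0, hpn, hp⟩ := ih i k h1
    have hvw : p n = (fun t : ℕ => if t = 0 then k else j) 0 := by simpa using hpn
    refine ⟨glue n p (fun t => if t = 0 then k else j), ?_, ?_, ?_⟩
    · rw [glue_le (Nat.zero_le _), hp0]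
    · rw [glue_add hvw]; simp
    · apply glue_path hp _ hvw
      intro t ht
      have : t = 0 := by omega
      subst this; simpa using h2

/-- Points of the subshift that carry the prefix of `u` at all multiples of `M`. -/
def markSet {l : ℕ} (SA : Set (ℕ → Fin l)) (u : ℕ → Fin l) (s M : ℕ) : Set (ℕ → Fin l) :=
  {x | x ∈ SA ∧ ∀ i, ∀ r ≤ s, x (i * M + r) = u r}

lemma exists_block {l : ℕ} {A : Matrix (Fin l) (Fin l) ℕ} (h01 : ∀ i j, A i j = 0 ∨ A i j = 1)
    {d : ℕ} (hap : ∀ i j, 0 < (A ^ d) i j) {u a : ℕ → Fin l} (s m : ℕ)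
    (hu : ∀ n, A (u n) (u (n + 1)) = 1) (ha : ∀ n, A (a n) (a (n + 1)) = 1) :
    ∃ v : ℕ → Fin l, IsPth A v (s + (d + (m + d))) ∧ v (s + (d + (m + d))) = u 0 ∧
      (∀ r ≤ s, v r = u r) ∧ (∀ i ≤ m, v (s + d + i) = a i) := by
  obtain ⟨p, hp0, hpd, hp⟩ := exists_path h01 d (u s) (a 0) (hap _ _)
  obtain ⟨q, hq0, hqd, hq⟩ := exists_path h01 d (a m) (u 0) (hap _ _)
  have e1 : a m = q 0 := hq0.symm
  have e2 : p d = glue m a q 0 := by rw [glue_le (Nat.zero_le _), hpd]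
  have e3 : u s = glue d p (glue m a q) 0 := by rw [glue_le (Nat.zero_le _), hp0]
  refine ⟨glue s u (glue d p (glue m a q)), ?_, ?_, ?_, ?_⟩
  · exact glue_path (fun t _ => hu t) (glue_path hp (glue_path (fun t _ => ha t) hq e1) e2) e3
  · rw [glue_add e3, glue_add e2, glue_add e1, hqd]
  · intro r hr; rw [glue_le hr]
  · intro i hi
    rw [add_assoc, glue_add e3, glue_add e2, glue_le hi]

lemma markSet_nonempty {l : ℕ} {A : Matrix (Fin l) (Fin l) ℕ} {SA : Set (ℕ → Fin l)}
    (hSA : SA = {x | ∀ n, A (x n) (x (n + 1)) = 1}) {u v : ℕ → Fin l} {s M : ℕ} (hsM : s < M)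
    (hv : IsPth A v M) (hvM : v M = u 0) (hvu : ∀ r ≤ s, v r = u r) :
    (markSet SA u s M).Nonempty := by
  have hM : 0 < M := by omega
  refine ⟨fun n => v (n % M), ?_, ?_⟩
  · rw [hSA]
    intro n
    dsimp only
    have hlt := Nat.mod_lt n hM
    by_cases h : n % M + 1 < M
    · have : (n + 1) % M = n % M + 1 := by
        rw [Nat.add_mod, Nat.mod_eq_of_lt (show 1 < M by omega), Nat.mod_eq_of_lt h]
      rw [this]; exact hv _ hlt
    · have h' : n % M + 1 = M := by omega
      have : (n + 1) % M = 0 := by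
        rw [← Nat.mod_add_mod, h', Nat.mod_self]
      have h3 := hv _ hlt
      rw [h', hvM] at h3
      rw [this, hvu 0 (Nat.zero_le _)]; exact h3
  · intro i r hr
    dsimp only
    rw [Nat.add_comm, Nat.add_mul_mod_self_right, Nat.mod_eq_of_lt (by omega)]
    exact hvu r hr

lemma markSet_prepend {l : ℕ} {A : Matrix (Fin l) (Fin l) ℕ} {SA : Set (ℕ → Fin l)}
    (hSA : SA = {x | ∀ n, A (x n) (x (n + 1)) = 1}) {u v y : ℕ → Fin l} {s M : ℕ} (hsM : s < M)
    (hv : IsPth A v M) (hvM : v M = u 0) (hvu : ∀ r ≤ s, v r = u r) (hy : y ∈ markSet SA u s M) :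
    v M = y 0 ∧ glue M v y ∈ markSet SA u s M := by
  have h0 : v M = y 0 := by
    have := hy.2 0 0 (Nat.zero_le _)
    rw [hvM, ← this]; simp
  refine ⟨h0, ?_, ?_⟩
  · rw [hSA]
    intro n
    have hyS := hy.1
    rw [hSA] at hyS
    exact glue_path (k := n + 1) hv (fun t _ => hyS t) h0 n (by omega)
  · intro i r hr
    cases i with
    | zero => rw [Nat.zero_mul, Nat.zero_add, glue_le (by omega)]; exact hvu r hr
    | succ i =>
      rw [show (i + 1) * M + r = M + (i * M + r) by ring, glue_add h0]
      exact hy.2 i r hr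

lemma markSet_avoid {l : ℕ} {SA : Set (ℕ → Fin l)} {u z : ℕ → Fin l} {s M L : ℕ} (hM : 0 < M)
    (hL : M + s < L) (hu : ∀ j, 1 ≤ j → j ≤ M → ¬ ∀ r ≤ s, z (j + r) = u r) :
    markSet SA u s M ⊆ SA \ ⋃ k : ℕ, shiftSeq^[k] ⁻¹' cyl z L := by
  rintro x ⟨hxS, hx⟩
  refine ⟨hxS, ?_⟩
  rw [Set.mem_iUnion]
  rintro ⟨k, hk⟩
  have h1 := Nat.div_add_mod k M
  have h2 := Nat.mod_lt k hM
  apply hu (M - k % M) (by omega) (by omega)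
  intro r hr
  have := hk (M - k % M + r) (by omega)
  rw [shift_iter] at this
  rw [← this, ← hx (k / M + 1) r hr]
  congr 1
  have : (k / M + 1) * M = M * (k / M) + M := by ring
  omega

lemma birk_dist {l : ℕ} {θ : ℝ} (hθ : 0 < θ) (hθ1 : θ < 1) {φ : (ℕ → Fin l) → ℝ} {Kφ : ℝ}
    (hK : 0 ≤ Kφ)
    (hφ : ∀ x y : ℕ → Fin l, ∀ n : ℕ, (∀ i < n, x i = y i) → |φ x - φ y| ≤ Kφ * θ ^ n)
    (m : ℕ) : ∀ (x y : ℕ → Fin l), (∀ i < m, x i = y i) →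
    |birk φ m x - birk φ m y| ≤ Kφ * (1 - θ)⁻¹ := by
  have h1θ : 0 < 1 - θ := by linarith
  intro x y hxy
  unfold birk
  rw [← Finset.sum_sub_distrib]
  refine (Finset.abs_sum_le_sum_abs _ _).trans ?_
  have h1 : ∀ i ∈ Finset.range m, |φ (shiftSeq^[i] x) - φ (shiftSeq^[i] y)|
      ≤ Kφ * θ ^ (m - 1 - i) := by
    intro i hi
    rw [Finset.mem_range] at hi
    refine (hφ _ _ (m - i) ?_).trans ?_
    · intro j hj
      rw [shift_iter, shift_iter]; exact hxy _ (by omega)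
    · apply mul_le_mul_of_nonneg_left _ hK
      exact pow_le_pow_of_le_one hθ.le hθ1.le (by omega)
  refine (Finset.sum_le_sum h1).trans ?_
  rw [← Finset.mul_sum, Finset.sum_range_reflect (fun i => θ ^ i) m]
  apply mul_le_mul_of_nonneg_left _ hK
  rw [← tsum_geometric_of_lt_one hθ.le hθ1]
  exact (summable_geometric_of_lt_one hθ.le hθ1).sum_le_tsum _ (fun i _ => by positivity)

lemma step {l : ℕ} {A : Matrix (Fin l) (Fin l) ℕ} (h01 : ∀ i j, A i j = 0 ∨ A i j = 1)
    {e : ℕ} (hap : ∀ i j, 0 < (A ^ (e + 1)) i j) {SA : Set (ℕ → Fin l)}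
    (hSA : SA = {x | ∀ n, A (x n) (x (n + 1)) = 1})
    {φ : (ℕ → Fin l) → ℝ} {B C : ℝ} (hB : ∀ x, |φ x| ≤ B)
    (hC : ∀ m, ∀ (x y : ℕ → Fin l), (∀ i < m, x i = y i) → |birk φ m x - birk φ m y| ≤ C)
    {u : ℕ → Fin l} (hu : u ∈ SA) (s m M : ℕ) (hM : M = s + (e + 1) + (m + 1) + e) (n : ℕ) :
    Real.exp (-(C + (s + (e + 1) + e) * B)) * (partSum φ (m + 1) SA *
      partSum φ n (markSet SA u s M)) ≤ partSum φ (M + n) (markSet SA u s M) := by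
  set X := markSet SA u s M with hX
  have hM' : M = s + ((e + 1) + (m + (e + 1))) := by omega
  have hu' := hu
  rw [hSA] at hu'
  have hex : ∀ a : Fin (m + 1) → Fin l, ∃ v : ℕ → Fin l,
      (∀ i : Fin (m + 1), v (s + (e + 1) + i) = a i) ∧
      ((cylword a ∩ SA).Nonempty → IsPth A v M ∧ v M = u 0 ∧ (∀ r ≤ s, v r = u r)) := by
    intro a
    by_cases h : (cylword a ∩ SA).Nonempty
    · obtain ⟨α, hα, hαS⟩ := id h
      rw [hSA] at hαS
      obtain ⟨v, h1, h2, h3, h4⟩ := exists_block h01 hap s m hu' hαS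
      rw [← hM'] at h1 h2
      refine ⟨v, fun i => ?_, fun _ => ⟨h1, h2, h3⟩⟩
      rw [h4 i (by omega)]; exact hα i
    · refine ⟨fun t => if ht : t - (s + (e + 1)) < m + 1 then a ⟨_, ht⟩ else u 0, ?_,
        fun h' => absurd h' h⟩
      intro i
      have hi := i.2
      simp
      omega
  choose v hva hv using hex
  let f : (Fin (m + 1) → Fin l) × (Fin n → Fin l) → (Fin (M + n) → Fin l) :=
    fun p => Fin.append (fun i : Fin M => v p.1 i) p.2
  have hf : Function.Injective f := by
    rintro ⟨a, b⟩ ⟨a', b'⟩ h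
    have h1 : ∀ i : Fin M, v a i = v a' i := by
      intro i
      have := congrFun h (Fin.castAdd n i)
      simpa [f] using this
    have h2 : b = b' := by
      funext i
      have := congrFun h (Fin.natAdd M i)
      simpa [f] using this
    have h3 : a = a' := by
      funext i
      rw [← hva a, ← hva a']
      exact h1 ⟨s + (e + 1) + i, by omega⟩
    rw [h2, h3]
  have hmain : ∀ p : (Fin (m + 1) → Fin l) × (Fin n → Fin l),
      Real.exp (-(C + (s + (e + 1) + e) * B)) * (pterm φ (m + 1) SA p.1 * pterm φ n X p.2)
        ≤ pterm φ (M + n) X (f p) := by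
    rintro ⟨a, b⟩
    dsimp only
    by_cases ha : (cylword a ∩ SA).Nonempty
    swap
    · rw [pterm_of_not ha]; simp [pterm_nonneg]
    by_cases hb : (cylword b ∩ X).Nonempty
    swap
    · rw [pterm_of_not hb]; simp [pterm_nonneg]
    obtain ⟨hv1, hv2, hv3⟩ := hv a ha
    have hsM : s < M := by omega
    have hpre : ∀ y ∈ cylword b ∩ X, shiftSeq^[M] (glue M (v a) y) = y ∧
        glue M (v a) y ∈ cylword (f (a, b)) ∩ X := by
      rintro y ⟨hyb, hyX⟩
      obtain ⟨h0, h1⟩ := markSet_prepend hSA hsM hv1 hv2 hv3 hyX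
      have hsh : shiftSeq^[M] (glue M (v a) y) = y := by
        funext t
        rw [shift_iter, glue_add h0]
      refine ⟨hsh, ?_, h1⟩
      rw [mem_cyl_append]
      refine ⟨fun i => glue_le i.2.le, ?_⟩
      rw [hsh]; exact hyb
    obtain ⟨y0, hy0⟩ := id hb
    rw [pterm_of ha, pterm_of hb, pterm_of ⟨_, (hpre y0 hy0).2⟩, ← Real.exp_add, ← Real.exp_add]
    apply Real.exp_le_exp.2
    have hbig : ∀ α ∈ cylword a ∩ SA, ∀ y ∈ cylword b ∩ X,
        birk φ (m + 1) α + birk φ n y - (C + (s + (e + 1) + e) * B) ≤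
          sSup (birk φ (M + n) '' (cylword (f (a, b)) ∩ X)) := by
      intro α hα y hy
      obtain ⟨hsh, hmem⟩ := hpre y hy
      refine le_trans ?_ (le_csSup (birk_bdd hB _ _) ⟨_, hmem, rfl⟩)
      rw [birk_add φ M n, hsh]
      set x := glue M (v a) y with hx
      have e1 : birk φ M x = birk φ (s + (e + 1)) x + birk φ (m + 1) (shiftSeq^[s + (e + 1)] x)
          + birk φ e (shiftSeq^[s + (e + 1) + (m + 1)] x) := by
        rw [hM, birk_add φ (s + (e + 1) + (m + 1)) e, birk_add φ (s + (e + 1)) (m + 1)]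
      have b1 := (abs_le.1 (birk_abs hB (s + (e + 1)) x)).1
      have b2 := (abs_le.1 (birk_abs hB e (shiftSeq^[s + (e + 1) + (m + 1)] x))).1
      have b3 := (abs_le.1 (hC (m + 1) (shiftSeq^[s + (e + 1)] x) α (by
        intro i hi
        rw [shift_iter, hx, glue_le (by omega)]
        have := hva a ⟨i, hi⟩
        rw [this]; exact (hα.1 ⟨i, hi⟩).symm))).1
      rw [e1]
      push_cast at b1
      linarith
    have h1 : ∀ y ∈ cylword b ∩ X, sSup (birk φ (m + 1) '' (cylword a ∩ SA)) ≤
        sSup (birk φ (M + n) '' (cylword (f (a, b)) ∩ X)) + (C + (s + (e + 1) + e) * B)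
          - birk φ n y := by
      intro y hy
      apply csSup_le (ha.image _)
      rintro _ ⟨α, hα, rfl⟩
      linarith [hbig α hα y hy]
    have h2 : sSup (birk φ n '' (cylword b ∩ X)) ≤
        sSup (birk φ (M + n) '' (cylword (f (a, b)) ∩ X)) + (C + (s + (e + 1) + e) * B)
          - sSup (birk φ (m + 1) '' (cylword a ∩ SA)) := by
      apply csSup_le (hb.image _)
      rintro _ ⟨y, hy, rfl⟩
      linarith [h1 y hy]
    linarith
  rw [partSum_eq, partSum_eq, partSum_eq, Fintype.sum_mul_sum, ← Fintype.sum_prod_type',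
    Finset.mul_sum]
  refine (Finset.sum_le_sum (fun p _ => hmain p)).trans ?_
  classical
  rw [← Finset.sum_image (f := fun w => pterm φ (M + n) X w) (g := f) (hf.injOn)]
  exact Finset.sum_le_univ_sum_of_nonneg (fun w => pterm_nonneg _ _ _ _)

lemma exists_marker {l : ℕ} {SA : Set (ℕ → Fin l)} (z : ℕ → Fin l) (s M : ℕ)
    (h : (M : ℝ) < partSum (fun _ => (0 : ℝ)) (s + 1) SA) :
    ∃ u ∈ SA, ∀ j, 1 ≤ j → j ≤ M → ¬ ∀ r ≤ s, z (j + r) = u r := by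
  classical
  let W := Finset.univ.filter (fun w : Fin (s + 1) → Fin l => (cylword w ∩ SA).Nonempty)
  let V := (Finset.Icc 1 M).image (fun j => fun i : Fin (s + 1) => z (j + i.1))
  have hW : partSum (fun _ => (0 : ℝ)) (s + 1) SA = W.card := by
    rw [partSum_eq, Finset.card_filter]
    push_cast
    apply Finset.sum_congr rfl
    intro w _
    split_ifs with hw
    · rw [pterm_of hw]
      have : birk (fun _ => (0 : ℝ)) (s + 1) = fun _ : ℕ → Fin l => (0 : ℝ) := by
        funext x; simp [birk]
      rw [this, hw.image_const]
      simp
    · rw [pterm_of_not hw]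
  have hV : V.card ≤ M := Finset.card_image_le.trans (by simp)
  have hlt : V.card < W.card := by
    rw [hW] at h
    have : M < W.card := by exact_mod_cast h
    omega
  obtain ⟨w, hwW, hwV⟩ := Finset.exists_mem_notMem_of_card_lt_card hlt
  obtain ⟨u, huw, huS⟩ := (Finset.mem_filter.1 hwW).2
  refine ⟨u, huS, fun j h1 h2 hj => hwV ?_⟩
  refine Finset.mem_image.2 ⟨j, Finset.mem_Icc.2 ⟨h1, h2⟩, ?_⟩
  funext i
  rw [hj i (by omega)]; exact huw i

lemma choose_s (h ε a : ℝ) (hh : 0 < h) (hε : 0 < ε) (ha : 0 ≤ a) (c : ℕ) :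
    ∃ s : ℕ, ((s : ℝ) ^ 2 + s + c < Real.exp ((s + 1 : ℕ) * h)) ∧
      a * (s + 1) ≤ ((s ^ 2 + 1 : ℕ) : ℝ) * ε := by
  obtain ⟨s, hs⟩ := exists_nat_gt (max 1 (max (2 * a / ε) ((2 + c) * 6 / h ^ 3)))
  have h1 := (le_max_left _ _).trans_lt hs
  have h2 := ((le_max_left _ _).trans (le_max_right _ _)).trans_lt hs
  have h3 := ((le_max_right _ _).trans (le_max_right _ _)).trans_lt hs
  rw [div_lt_iff₀ hε] at h2
  rw [div_lt_iff₀ (by positivity)] at h3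
  have hc : (0 : ℝ) ≤ c := Nat.cast_nonneg c
  refine ⟨s, ?_, ?_⟩
  · have h4 := Real.pow_div_factorial_le_exp (x := (s : ℝ) * h) (by positivity) 3
    have h5 : Real.exp ((s : ℝ) * h) ≤ Real.exp ((s + 1 : ℕ) * h) := by
      apply Real.exp_le_exp.2
      push_cast; nlinarith
    refine lt_of_lt_of_le ?_ (h4.trans h5)
    have h6 : ((Nat.factorial 3 : ℕ) : ℝ) = 6 := by norm_num [Nat.factorial]
    rw [h6, lt_div_iff₀ (by norm_num)]
    have h7 : (s : ℝ) ^ 2 * ((2 + c) * 6) < (s : ℝ) ^ 2 * (s * h ^ 3) := by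
      apply mul_lt_mul_of_pos_left h3; positivity
    have h8 : (s : ℝ) ≤ s ^ 2 := by nlinarith
    have h9 : (c : ℝ) ≤ c * s ^ 2 := by nlinarith
    nlinarith
  · push_cast
    nlinarith

lemma key {l : ℕ}
    {A : Matrix (Fin l) (Fin l) ℕ} (h01 : ∀ i j, A i j = 0 ∨ A i j = 1)
    {e : ℕ} (hap : ∀ i j, 0 < (A ^ (e + 1)) i j) {SA : Set (ℕ → Fin l)}
    (hSA : SA = {x | ∀ n, A (x n) (x (n + 1)) = 1})
    {φ : (ℕ → Fin l) → ℝ} {B C : ℝ} (hB : ∀ x, |φ x| ≤ B) (hC0 : 0 ≤ C)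
    (hC : ∀ m, ∀ (x y : ℕ → Fin l), (∀ i < m, x i = y i) → |birk φ m x - birk φ m y| ≤ C)
    (hent : 0 < pressOn (fun _ => (0 : ℝ)) SA)
    {z : ℕ → Fin l} (hz : z ∈ SA) {ε : ℝ} (hε : 0 < ε) :
    ∃ L0, ∀ L ≥ L0, (SA \ ⋃ k : ℕ, shiftSeq^[k] ⁻¹' cyl z L).Nonempty ∧
      pressOn φ SA - ε ≤ pressOn φ (SA \ ⋃ k : ℕ, shiftSeq^[k] ⁻¹' cyl z L) := by
  have hinv : ∀ x ∈ SA, ∀ k, shiftSeq^[k] x ∈ SA := by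
    intro x hx k
    rw [hSA] at hx ⊢
    intro n
    rw [shift_iter, shift_iter]
    exact hx (k + n)
  have hSn : SA.Nonempty := ⟨z, hz⟩
  have hB0 : 0 ≤ B := (abs_nonneg _).trans (hB z)
  set P := pressOn φ SA with hP
  set h := pressOn (fun _ => (0 : ℝ)) SA with hh
  obtain ⟨s, hs1, hs2⟩ := choose_s h ε (C + (2 * e + 1) * (B + |P|)) hent hε (by positivity)
    (2 * e + 2)
  obtain ⟨M, hM⟩ : ∃ M, M = s + (e + 1) + (s ^ 2 + 1) + e := ⟨_, rfl⟩
  have hN : (M : ℝ) < partSum (fun _ => (0 : ℝ)) (s + 1) SA := by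
    have h0 : ∀ x : ℕ → Fin l, |(fun _ : ℕ → Fin l => (0 : ℝ)) x| ≤ 0 := by simp
    have h1 := press_le_log h0 hSn hinv (s + 1) (by omega)
    rw [← hh, Real.le_log_iff_exp_le (partSum_pos h0 _ hSn)] at h1
    refine lt_of_lt_of_le ?_ h1
    rw [hM]
    refine lt_of_le_of_lt ?_ hs1
    push_cast; linarith
  obtain ⟨u, huS, hu⟩ := exists_marker z s M hN
  set X := markSet SA u s M with hX
  have hsM : s < M := by omega
  have hXn : X.Nonempty := by
    have hzS := hz
    have huS' := huS
    rw [hSA] at hzS huS'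
    obtain ⟨v, h1, h2, h3, -⟩ := exists_block h01 hap s (s ^ 2) huS' hzS
    have hM' : s + ((e + 1) + (s ^ 2 + (e + 1))) = M := by omega
    rw [hM'] at h1 h2
    exact markSet_nonempty hSA hsM h1 h2 h3
  have hM0 : (0 : ℝ) < M := by
    have : 0 < M := by omega
    exact_mod_cast this
  set D := C + (s + (e + 1) + e) * B with hD
  set Z := partSum φ (s ^ 2 + 1) SA with hZ
  have hZ0 : 0 < Z := partSum_pos hB _ hSn
  have hind : ∀ k : ℕ, (k : ℝ) * (Real.log Z - D) ≤ Real.log (partSum φ (k * M) X) := by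
    intro k
    induction k with
    | zero =>
      have h1 := partSum_lower hB 0 hXn
      rw [Nat.zero_mul]
      simp only [Nat.cast_zero, zero_mul, neg_zero, Real.exp_zero] at h1 ⊢
      exact Real.log_nonneg h1
    | succ k ih =>
      have h1 := step h01 hap hSA hB hC huS s (s ^ 2) M hM (k * M)
      rw [← hX, ← hD, ← hZ] at h1
      have hk := partSum_pos hB (k * M) hXn
      have h2 := Real.log_le_log (by positivity) h1
      rw [Real.log_mul (by positivity) (by positivity), Real.log_mul hZ0.ne' hk.ne',
        Real.log_exp] at h2
      rw [show (k + 1) * M = M + k * M by ring]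
      push_cast
      linarith
  have hPX : P - ε ≤ pressOn φ X := by
    unfold pressOn
    apply le_limsup_of_frequently_le _ (press_bdd hB hXn).1
    rw [frequently_atTop]
    intro N
    refine ⟨(N + 1) * M, ?_, ?_⟩
    · have : 1 ≤ M := by omega
      nlinarith
    · have hN0 : (0 : ℝ) < ((N + 1 : ℕ) : ℝ) := by positivity
      have h1 := hind (N + 1)
      rw [Nat.cast_mul, le_div_iff₀ (by positivity)]
      refine le_trans ?_ h1
      have h2 := press_le_log hB hSn hinv (s ^ 2 + 1) (by omega)
      rw [← hP, ← hZ] at h2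
      have h3 : (P - ε) * M ≤ Real.log Z - D := by
        refine le_trans ?_ (sub_le_sub_right h2 D)
        have hPa := le_abs_self P
        have hPn := abs_nonneg P
        have hMr : (M : ℝ) = ((s ^ 2 + 1 : ℕ) : ℝ) + (s + (e + 1) + e) := by
          rw [hM]; push_cast; ring
        rw [hMr]
        set q : ℝ := ((s ^ 2 + 1 : ℕ) : ℝ)
        have hs0 : (0 : ℝ) ≤ s := Nat.cast_nonneg s
        have he0 : (0 : ℝ) ≤ e := Nat.cast_nonneg e
        have hg : (s + (e + 1) + e : ℝ) * (B + P - ε) ≤ (2 * e + 1) * (s + 1) * (B + |P|) := by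
          have g1 : (s + (e + 1) + e : ℝ) ≤ (2 * e + 1) * (s + 1) := by nlinarith
          have g0 : (0 : ℝ) ≤ (s + (e + 1) + e : ℝ) := by positivity
          calc (s + (e + 1) + e : ℝ) * (B + P - ε) ≤ (s + (e + 1) + e : ℝ) * (B + |P|) := by
                apply mul_le_mul_of_nonneg_left _ g0; linarith
            _ ≤ _ := by apply mul_le_mul_of_nonneg_right g1; positivity
        have hCs : C ≤ C * (s + 1) := by nlinarith
        rw [hD]
        nlinarith
      calc (P - ε) * (((N + 1 : ℕ) : ℝ) * M) = ((N + 1 : ℕ) : ℝ) * ((P - ε) * M) := by ring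
        _ ≤ _ := mul_le_mul_of_nonneg_left h3 hN0.le
  refine ⟨M + s + 1, fun L hL => ?_⟩
  have hsub := markSet_avoid (SA := SA) (z := z) (L := L) (by omega : 0 < M) (by omega) hu
  exact ⟨hXn.mono hsub, hPX.trans (press_mono hB hXn hsub)⟩

/-- convergence of restricted pressures: for a mixing subshift of finite
type `Σ_A` with positive topological entropy, a Hölder potential `φ`, a point `z ∈ Σ_A`
and lengths `l_n → ∞`, the pressures of `φ` restricted to
`Σ̃_n = Σ_A \ ∪_{k ≥ 0} σ^{-k}[z]_{l_n}` converge to `P(φ)`. -/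
theorem restricted_pressure_tendsto {l : ℕ}
    (A : Matrix (Fin l) (Fin l) ℕ) (h01 : ∀ i j, A i j = 0 ∨ A i j = 1)
    (d : ℕ) (hd : 1 ≤ d) (hap : ∀ i j, 0 < (A ^ d) i j)
    (θ : ℝ) (hθ : 0 < θ) (hθ1 : θ < 1)
    (φ : (ℕ → Fin l) → ℝ) (Kφ : ℝ)
    (hφ : ∀ x y : ℕ → Fin l, ∀ n : ℕ, (∀ i < n, x i = y i) → |φ x - φ y| ≤ Kφ * θ ^ n)
    (SA : Set (ℕ → Fin l)) (hSA : SA = {x | ∀ n, A (x n) (x (n + 1)) = 1})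
    (hent : 0 < pressOn (fun _ => (0 : ℝ)) SA)
    (z : ℕ → Fin l) (hz : z ∈ SA)
    (ln : ℕ → ℕ) (hln : Tendsto ln atTop atTop) :
    Tendsto (fun n => pressOn φ (SA \ ⋃ k : ℕ, shiftSeq^[k] ⁻¹' cyl z (ln n)))
      atTop (nhds (pressOn φ SA)) := by
  obtain ⟨e, rfl⟩ : ∃ e, d = e + 1 := ⟨d - 1, by omega⟩
  have hK : 0 ≤ Kφ := by
    have := hφ z z 0 (fun _ _ => rfl)
    simpa using this
  have hB : ∀ x, |φ x| ≤ |φ z| + Kφ := by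
    intro x
    have h1 := hφ x z 0 (fun i hi => absurd hi (by omega))
    have h2 := abs_sub_abs_le_abs_sub (φ x) (φ z)
    simp only [pow_zero, mul_one] at h1
    linarith
  have hC0 : 0 ≤ Kφ * (1 - θ)⁻¹ := mul_nonneg hK (inv_nonneg.2 (by linarith))
  have hC := birk_dist hθ hθ1 hK hφ
  rw [Metric.tendsto_atTop]
  intro ε hε
  obtain ⟨L0, hL0⟩ := key h01 hap hSA hB hC0 hC hent hz (half_pos hε)
  obtain ⟨N, hN⟩ := (hln.eventually_ge_atTop L0).exists_forall_of_atTop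
  refine ⟨N, fun n hn => ?_⟩
  obtain ⟨h1, h2⟩ := hL0 (ln n) (hN n hn)
  have h3 := press_mono hB h1 Set.sdiff_subset
  rw [Real.dist_eq, abs_lt]
  constructor <;> linarith

end
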